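/- For all r ∈ (0,1), 2/π − 16/25 < (2/π) E(r) − S_{5/2,2}(1, √(1−r²)) < 0, where E is the complete elliptic integral of the second kind and S_{5/2,2}(1,x) = ((4/5)(1−x^{5/2})/(1−x²))². -/

import Mathlib

open Real

/-- Complete elliptic integral of the second kind. -/
noncomputable def ellipticE (r : ℝ) : ℝ :=
  ∫ t in (0:ℝ)..(π / 2), Real.sqrt (1 - r ^ 2 * Real.sin t ^ 2)

/-- The Stolarsky mean `S_{5/2,2}(1,x)`. -/
noncomputable def S52 (x : ℝ) : ℝ := (4 / 5 * (1 - x ^ ((5:ℝ) / 2)) / (1 - x ^ 2)) ^ 2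

lemma norm_sq_sum_exp (a : ℕ → ℝ) (N : ℕ) (φ : ℝ) :
    ‖∑ n ∈ Finset.range N, (a n : ℂ) * Complex.exp (n * φ * Complex.I)‖ ^ 2 =
      ∑ n ∈ Finset.range N, ∑ m ∈ Finset.range N, a n * a m * cos (((n : ℝ) - m) * φ) := by
  have key (n : ℕ) : (a n : ℂ) * Complex.exp (n * φ * Complex.I) =
      ((a n * cos (n * φ) : ℝ) : ℂ) + ((a n * sin (n * φ) : ℝ) : ℂ) * Complex.I := by
    rw [Complex.exp_mul_I]
    push_cast
    ring
  simp only [key]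
  rw [Finset.sum_add_distrib, ← Finset.sum_mul, ← Complex.ofReal_sum, ← Complex.ofReal_sum,
    ← Complex.normSq_eq_norm_sq, Complex.normSq_add_mul_I, sq, sq, Finset.sum_mul_sum,
    Finset.sum_mul_sum, ← Finset.sum_add_distrib]
  refine Finset.sum_congr rfl fun n _ => ?_
  rw [← Finset.sum_add_distrib]
  refine Finset.sum_congr rfl fun m _ => ?_
  rw [sub_mul, cos_sub]
  ring

lemma integral_cos_nat_sub_mul (n m : ℕ) :
    ∫ φ in (0:ℝ)..π, cos (((n : ℝ) - m) * φ) = if n = m then π else 0 := by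
  split_ifs with h
  · simp [h]
  · have h' : (n : ℝ) - m ≠ 0 := sub_ne_zero.2 (by exact_mod_cast h)
    rw [intervalIntegral.integral_comp_mul_left _ h', integral_cos]
    have : sin (((n : ℝ) - m) * π) = 0 := by
      have := sin_int_mul_pi ((n : ℤ) - m)
      push_cast at this
      exact this
    simp [this]

lemma integral_norm_sq_sum_exp (a : ℕ → ℝ) (N : ℕ) :
    ∫ φ in (0:ℝ)..π, ‖∑ n ∈ Finset.range N, (a n : ℂ) * Complex.exp (n * φ * Complex.I)‖ ^ 2 =
      π * ∑ n ∈ Finset.range N, a n ^ 2 := by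
  simp only [norm_sq_sum_exp]
  rw [intervalIntegral.integral_finsetSum fun n _ =>
    Continuous.intervalIntegrable (by fun_prop) _ _, Finset.mul_sum]
  refine Finset.sum_congr rfl fun n hn => ?_
  rw [intervalIntegral.integral_finsetSum fun n _ =>
    Continuous.intervalIntegrable (by fun_prop) _ _]
  simp only [intervalIntegral.integral_const_mul, integral_cos_nat_sub_mul]
  simp only [mul_ite, mul_zero, Finset.sum_ite_eq, hn, if_true]
  ring

/-- Parseval's identity on a half period, for absolutely convergent Fourier series with real
coefficients and no negative frequencies. -/
lemma hasSum_sq_of_hasSum_exp {a : ℕ → ℝ} {f : ℝ → ℂ} (ha : Summable fun n => |a n|)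
    (hf : ∀ φ : ℝ, HasSum (fun n : ℕ => (a n : ℂ) * Complex.exp (n * φ * Complex.I)) (f φ)) :
    HasSum (fun n => π * a n ^ 2) (∫ φ in (0:ℝ)..π, ‖f φ‖ ^ 2) := by
  rw [hasSum_iff_tendsto_nat_of_nonneg (fun n => by positivity)]
  simp only [← Finset.mul_sum, ← integral_norm_sq_sum_exp]
  refine intervalIntegral.tendsto_integral_filter_of_dominated_convergence
    (fun _ => (∑' n, |a n|) ^ 2) (.of_forall fun N => Continuous.aestronglyMeasurable (by fun_prop))
    (.of_forall fun N => .of_forall fun φ _ => ?_) (by simp) (.of_forall fun φ _ => ?_)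
  · rw [norm_pow, norm_norm]
    gcongr
    refine (norm_sum_le _ _).trans ?_
    refine le_trans (le_of_eq ?_) (ha.sum_le_tsum (Finset.range N) fun _ _ => abs_nonneg _)
    refine Finset.sum_congr rfl fun n _ => ?_
    have := Complex.norm_exp_ofReal_mul_I (n * φ)
    push_cast at this
    rw [norm_mul, this, mul_one, Complex.norm_real, norm_eq_abs]
  · exact ((hf φ).tendsto_sum_nat.norm).pow 2

lemma hasSum_choose_half {z : ℂ} (hz : ‖z‖ < 1) :
    HasSum (fun n : ℕ => ((Ring.choose (1 / 2 : ℝ) n : ℝ) : ℂ) * z ^ n) ((1 + z) ^ (1 / 2 : ℂ)) := by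
  have h := (Complex.one_add_cpow_hasFPowerSeriesOnBall_zero (a := 1 / 2)).hasSum (y := z)
    (by simpa [← ofReal_norm] using hz)
  simp only [binomialSeries_apply, zero_add, List.ofFn_const, List.prod_replicate,
    smul_eq_mul] at h
  refine h.congr_fun fun n => ?_
  rw [Complex.ofReal_choose]
  norm_num

lemma norm_cpow_half_sq (w : ℂ) : ‖w ^ (1 / 2 : ℂ)‖ ^ 2 = ‖w‖ := by
  rw [← norm_pow, ← Complex.cpow_nat_mul]
  norm_num

lemma norm_one_add_mul_exp (k φ : ℝ) :
    ‖(1 : ℂ) + k * Complex.exp (φ * Complex.I)‖ = √(1 + k ^ 2 + 2 * k * cos φ) := by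
  have : (1 : ℂ) + k * Complex.exp (φ * Complex.I) =
      ((1 + k * cos φ : ℝ) : ℂ) + ((k * sin φ : ℝ) : ℂ) * Complex.I := by
    rw [Complex.exp_mul_I]
    push_cast
    ring
  rw [this, Complex.norm_add_mul_I]
  congr 1
  linear_combination k ^ 2 * sin_sq_add_cos_sq φ

lemma hasSum_integral_sqrt {k : ℝ} (hk0 : 0 ≤ k) (hk1 : k < 1) :
    HasSum (fun n : ℕ => π * (Ring.choose (1 / 2 : ℝ) n ^ 2 * (k ^ 2) ^ n))
      (∫ φ in (0:ℝ)..π, √(1 + k ^ 2 + 2 * k * cos φ)) := by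
  have hk : ‖(k : ℂ)‖ < 1 := by rwa [Complex.norm_real, norm_of_nonneg hk0]
  have hs : Summable fun n : ℕ => |Ring.choose (1 / 2 : ℝ) n * k ^ n| := by
    refine (hasSum_choose_half hk).summable.norm.congr fun n => ?_
    rw [← norm_eq_abs, ← Complex.norm_real]
    push_cast
    rfl
  have h := hasSum_sq_of_hasSum_exp hs
    (f := fun φ => (1 + k * Complex.exp (φ * Complex.I)) ^ (1 / 2 : ℂ)) fun φ => by
      have hz : ‖(k : ℂ) * Complex.exp (φ * Complex.I)‖ < 1 := by
        rwa [norm_mul, Complex.norm_exp_ofReal_mul_I, mul_one]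
      refine (hasSum_choose_half hz).congr_fun ?_
      intro n
      rw [mul_pow, ← Complex.exp_nat_mul]
      push_cast
      ring_nf
  simp only [norm_cpow_half_sq, norm_one_add_mul_exp] at h
  refine h.congr_fun fun n => ?_
  ring

lemma choose_half_succ_sq (n : ℕ) :
    Ring.choose (1 / 2 : ℝ) (n + 1) ^ 2 =
      Ring.choose (1 / 2 : ℝ) n ^ 2 * ((2 * n - 1) / (2 * n + 2)) ^ 2 := by
  have h := Ring.choose_smul_choose (1 / 2 : ℝ) (Nat.le_succ n)
  have h' : ((n : ℝ) + 1) * Ring.choose (1 / 2 : ℝ) (n + 1) =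
      Ring.choose (1 / 2 : ℝ) n * (1 / 2 - n) := by
    simpa [nsmul_eq_mul] using h
  have hn : (n : ℝ) + 1 ≠ 0 := by positivity
  rw [eq_div_of_mul_eq hn ((mul_comm _ _).trans h')]
  field_simp
  ring

lemma choose_half_sq_values :
    Ring.choose (1 / 2 : ℝ) 0 ^ 2 = 1 ∧ Ring.choose (1 / 2 : ℝ) 1 ^ 2 = 1 / 4 ∧
    Ring.choose (1 / 2 : ℝ) 2 ^ 2 = 1 / 64 ∧ Ring.choose (1 / 2 : ℝ) 3 ^ 2 = 1 / 256 ∧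
    Ring.choose (1 / 2 : ℝ) 4 ^ 2 = 25 / 16384 := by
  have h0 : Ring.choose (1 / 2 : ℝ) 0 ^ 2 = 1 := by simp
  have h1 : Ring.choose (1 / 2 : ℝ) 1 ^ 2 = 1 / 4 := by
    rw [choose_half_succ_sq, h0]
    norm_num
  have h2 : Ring.choose (1 / 2 : ℝ) 2 ^ 2 = 1 / 64 := by
    rw [choose_half_succ_sq, h1]
    norm_num
  have h3 : Ring.choose (1 / 2 : ℝ) 3 ^ 2 = 1 / 256 := by
    rw [choose_half_succ_sq, h2]
    norm_num
  refine ⟨h0, h1, h2, h3, ?_⟩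
  rw [choose_half_succ_sq, h3]
  norm_num

lemma sum_choose_half_sq_le {h : ℝ} (h0 : 0 ≤ h) (h1 : h ≤ 1) {N : ℕ} (hN : 3 ≤ N) :
    ∑ n ∈ Finset.range N, Ring.choose (1 / 2 : ℝ) n ^ 2 * h ^ n +
      N * Ring.choose (1 / 2 : ℝ) N ^ 2 * h ^ 3 ≤ 1 + h / 4 + h ^ 2 / 64 + 3 / 256 * h ^ 3 := by
  induction N, hN using Nat.le_induction with
  | base =>
    obtain ⟨e0, e1, e2, e3, -⟩ := choose_half_sq_values
    simp only [Finset.sum_range_succ, Finset.sum_range_zero, e0, e1, e2, e3]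
    push_cast
    linarith
  | succ N hN ih =>
    refine le_trans ?_ ih
    rw [Finset.sum_range_succ, choose_half_succ_sq]
    have hN' : (3 : ℝ) ≤ N := by exact_mod_cast hN
    have hpow : h ^ N ≤ h ^ 3 := pow_le_pow_of_le_one h0 h1 hN
    have hb := sq_nonneg (Ring.choose (1 / 2 : ℝ) N)
    have hc : 1 + ((N : ℝ) + 1) * ((2 * N - 1) / (2 * N + 2)) ^ 2 ≤ N := by
      have : ((N : ℝ) + 1) * ((2 * N - 1) / (2 * N + 2)) ^ 2 =
          (2 * N - 1) ^ 2 / (4 * (N + 1)) := by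
        field_simp
        ring
      rw [this, ← le_sub_iff_add_le', div_le_iff₀ (by positivity)]
      nlinarith
    have hbh : 0 ≤ Ring.choose (1 / 2 : ℝ) N ^ 2 * h ^ 3 := by positivity
    have k1 := mul_le_mul_of_nonneg_left hpow hb
    have k2 := mul_le_mul_of_nonneg_left hc hbh
    push_cast
    linarith

lemma ellipticE_eq_integral {r x : ℝ} (hx : 0 ≤ x) (hr : r ^ 2 = 1 - x ^ 2) :
    ellipticE r = (1 + x) / 4 * ∫ φ in (0:ℝ)..π,
      √(1 + ((1 - x) / (1 + x)) ^ 2 + 2 * ((1 - x) / (1 + x)) * cos φ) := by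
  set g : ℝ → ℝ := fun φ => √(1 + ((1 - x) / (1 + x)) ^ 2 + 2 * ((1 - x) / (1 + x)) * cos φ)
    with hg
  have hpt (t : ℝ) : √(1 - r ^ 2 * sin t ^ 2) = (1 + x) / 2 * g (2 * t) := by
    rw [hg, hr, ← sqrt_sq (show 0 ≤ (1 + x) / 2 by positivity), ← sqrt_mul (sq_nonneg _),
      cos_two_mul, sin_sq]
    congr 1
    field_simp
    ring
  have h2 : ∫ t in (0:ℝ)..(π / 2), g (2 * t) = 2⁻¹ * ∫ φ in (0:ℝ)..π, g φ := by
    rw [intervalIntegral.integral_comp_mul_left _ two_ne_zero, smul_eq_mul, mul_zero,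
      mul_div_cancel₀ _ two_ne_zero]
  rw [ellipticE]
  simp only [hpt, intervalIntegral.integral_const_mul, h2]
  ring

/-- The expansion of `ellipticE` in powers of the squared Landen modulus. -/
lemma hasSum_ellipticE {r x : ℝ} (hx0 : 0 < x) (hx1 : x < 1) (hr : r ^ 2 = 1 - x ^ 2) :
    HasSum (fun n : ℕ => (1 + x) / 2 *
        (Ring.choose (1 / 2 : ℝ) n ^ 2 * (((1 - x) / (1 + x)) ^ 2) ^ n))
      (2 / π * ellipticE r) := by
  have hk1 : (1 - x) / (1 + x) < 1 := by
    rw [div_lt_one (by positivity)]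
    linarith
  have h := (hasSum_integral_sqrt (div_nonneg (sub_nonneg.2 hx1.le) (by positivity)) hk1).mul_left
    (2 / π * ((1 + x) / 4))
  rw [ellipticE_eq_integral hx0.le hr, ← mul_assoc]
  refine h.congr_fun fun n => ?_
  field_simp
  ring

lemma ellipticE_le {r x : ℝ} (hx0 : 0 < x) (hx1 : x < 1) (hr : r ^ 2 = 1 - x ^ 2) :
    2 / π * ellipticE r ≤ (1 + x) / 2 * (1 + ((1 - x) / (1 + x)) ^ 2 / 4 +
      (((1 - x) / (1 + x)) ^ 2) ^ 2 / 64 + 3 / 256 * (((1 - x) / (1 + x)) ^ 2) ^ 3) := by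
  have hk : ((1 - x) / (1 + x)) ^ 2 ≤ 1 := by
    refine pow_le_one₀ (div_nonneg (by linarith) (by linarith)) ?_
    rw [div_le_one (by positivity)]
    linarith
  refine le_of_tendsto (hasSum_ellipticE hx0 hx1 hr).tendsto_sum_nat ?_
  filter_upwards [Filter.eventually_ge_atTop 3] with N hN
  rw [← Finset.mul_sum]
  gcongr
  refine le_trans ?_ (sum_choose_half_sq_le (sq_nonneg _) hk hN)
  exact le_add_of_nonneg_right (by positivity)

lemma le_ellipticE {r x : ℝ} (hx0 : 0 < x) (hx1 : x < 1) (hr : r ^ 2 = 1 - x ^ 2) :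
    (1 + x) / 2 * (1 + ((1 - x) / (1 + x)) ^ 2 / 4 + (((1 - x) / (1 + x)) ^ 2) ^ 2 / 64 +
      (((1 - x) / (1 + x)) ^ 2) ^ 3 / 256 + 25 / 16384 * (((1 - x) / (1 + x)) ^ 2) ^ 4) ≤
      2 / π * ellipticE r := by
  obtain ⟨e0, e1, e2, e3, e4⟩ := choose_half_sq_values
  refine le_trans (le_of_eq ?_)
    (sum_le_hasSum (Finset.range 5) (fun n _ => by positivity) (hasSum_ellipticE hx0 hx1 hr))
  simp only [Finset.sum_range_succ, Finset.sum_range_zero, e0, e1, e2, e3, e4]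
  ring

lemma le_sqrt_of_sq_add_sq_eq_one {c s x : ℝ} (hc : 0 ≤ c) (hs : 0 ≤ s) (hcs : s ^ 2 + c ^ 2 = 1)
    (hx : 0 < x) :
    c + x ^ 2 * (s / (2 * c + x)) - x ^ 2 * (c * s / 2) ≤ √(c ^ 2 + x ^ 2 * s ^ 2) := by
  have hs1 : s ≤ 1 := by nlinarith
  have hD : 0 < 2 * c + x := by positivity
  have hq : s / (2 * c + x) - c * s / 2 ≤ s ^ 2 / (2 * c + x) := by
    rw [sub_le_iff_le_add, div_le_iff₀ hD, add_mul, div_mul_cancel₀ _ hD.ne']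
    have : 0 ≤ s * (1 - s) * s + s * c * x / 2 :=
      add_nonneg (mul_nonneg (mul_nonneg hs (by linarith)) hs) (by positivity)
    nlinarith
  calc c + x ^ 2 * (s / (2 * c + x)) - x ^ 2 * (c * s / 2)
      = c + x ^ 2 * (s / (2 * c + x) - c * s / 2) := by ring
    _ ≤ c + x ^ 2 * (s ^ 2 / (2 * c + x)) := by gcongr
    _ ≤ √(c ^ 2 + x ^ 2 * s ^ 2) := by
      refine le_sqrt_of_sq_le ?_
      have e : c ^ 2 + x ^ 2 * s ^ 2 - (c + x ^ 2 * (s ^ 2 / (2 * c + x))) ^ 2 =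
          x ^ 3 * s ^ 2 * (2 * c + x * (1 - s ^ 2)) / (2 * c + x) ^ 2 := by
        field_simp
        ring
      have : 0 ≤ 1 - s ^ 2 := by nlinarith
      have : 0 ≤ x ^ 3 * s ^ 2 * (2 * c + x * (1 - s ^ 2)) / (2 * c + x) ^ 2 := by positivity
      linarith

lemma one_add_le_ellipticE {r x : ℝ} (hx : 0 < x) (hr : r ^ 2 = 1 - x ^ 2) :
    1 + x ^ 2 * ((log (2 + x) - log x) / 2 - 1 / 4) ≤ ellipticE r := by
  have hcos {t : ℝ} (ht : t ∈ Set.Icc 0 (π / 2)) : 0 ≤ cos t :=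
    cos_nonneg_of_mem_Icc ⟨by linarith [ht.1, pi_pos], ht.2⟩
  have hsin {t : ℝ} (ht : t ∈ Set.Icc 0 (π / 2)) : 0 ≤ sin t :=
    sin_nonneg_of_nonneg_of_le_pi ht.1 (by linarith [ht.2, pi_pos])
  have hpi : (0:ℝ) ≤ π / 2 := by positivity
  have hcont : ContinuousOn (fun t => cos t + x ^ 2 * (sin t / (2 * cos t + x)) -
      x ^ 2 * (cos t * sin t / 2)) (Set.uIcc 0 (π / 2)) := by
    have : ∀ t ∈ Set.uIcc 0 (π / 2), 2 * cos t + x ≠ 0 := fun t ht => by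
      have := hcos (Set.uIcc_of_le hpi ▸ ht)
      positivity
    fun_prop (disch := assumption)
  have hderiv : ∀ t ∈ Set.uIcc 0 (π / 2), HasDerivAt
      (fun t => sin t - x ^ 2 / 2 * log (2 * cos t + x) - x ^ 2 / 4 * sin t ^ 2)
      (cos t + x ^ 2 * (sin t / (2 * cos t + x)) - x ^ 2 * (cos t * sin t / 2)) t := by
    intro t ht
    have h0 : 2 * cos t + x ≠ 0 := by
      have := hcos (Set.uIcc_of_le hpi ▸ ht)
      positivity
    have h1 := (((hasDerivAt_cos t).const_mul 2).add_const x).log h0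
    have h2 := (hasDerivAt_sin t).pow 2
    refine (((hasDerivAt_sin t).sub (h1.const_mul (x ^ 2 / 2))).sub
      (h2.const_mul (x ^ 2 / 4))).congr_deriv ?_
    field_simp
    ring
  have hint := intervalIntegral.integral_eq_sub_of_hasDerivAt hderiv hcont.intervalIntegrable
  calc 1 + x ^ 2 * ((log (2 + x) - log x) / 2 - 1 / 4)
      = ∫ t in (0:ℝ)..(π / 2), (cos t + x ^ 2 * (sin t / (2 * cos t + x)) -
          x ^ 2 * (cos t * sin t / 2)) := by
        rw [hint]
        simp
        ring
    _ ≤ ellipticE r := by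
        refine intervalIntegral.integral_mono_on hpi hcont.intervalIntegrable
          (Continuous.intervalIntegrable (by fun_prop) _ _) fun t ht => ?_
        refine (le_sqrt_of_sq_add_sq_eq_one (hcos ht) (hsin ht) (sin_sq_add_cos_sq t)
          hx).trans_eq ?_
        rw [hr]
        congr 1
        linear_combination sin_sq_add_cos_sq t

lemma S52_sq {y : ℝ} (hy0 : 0 < y) (hy1 : y < 1) :
    S52 (y ^ 2) =
      16 / 25 * ((1 + y + y ^ 2 + y ^ 3 + y ^ 4) / ((1 + y) * (1 + y ^ 2))) ^ 2 := by
  have h5 : (y ^ 2) ^ ((5:ℝ) / 2) = y ^ 5 := by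
    rw [← rpow_natCast, ← rpow_natCast, ← rpow_mul hy0.le]
    norm_num
  have h4 : 1 - (y ^ 2) ^ 2 ≠ 0 := by
    have : (y ^ 2) ^ 2 < 1 := by
      rw [← pow_mul]
      exact pow_lt_one₀ hy0.le hy1 (by norm_num)
    linarith
  have e : (1 - y ^ 5) / (1 - (y ^ 2) ^ 2) =
      (1 + y + y ^ 2 + y ^ 3 + y ^ 4) / ((1 + y) * (1 + y ^ 2)) := by
    rw [div_eq_div_iff h4 (by positivity)]
    ring
  rw [S52, h5, mul_div_assoc, e]
  ring

lemma lt_S52_sq {y : ℝ} (hy0 : 0 < y) (hy1 : y < 1) :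
    (1 + y ^ 2) / 2 * (1 + ((1 - y ^ 2) / (1 + y ^ 2)) ^ 2 / 4 +
      (((1 - y ^ 2) / (1 + y ^ 2)) ^ 2) ^ 2 / 64 +
      3 / 256 * (((1 - y ^ 2) / (1 + y ^ 2)) ^ 2) ^ 3) < S52 (y ^ 2) := by
  rw [S52_sq hy0 hy1, ← sub_pos]
  have e : 16 / 25 * ((1 + y + y ^ 2 + y ^ 3 + y ^ 4) / ((1 + y) * (1 + y ^ 2))) ^ 2 -
      (1 + y ^ 2) / 2 * (1 + ((1 - y ^ 2) / (1 + y ^ 2)) ^ 2 / 4 +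
      (((1 - y ^ 2) / (1 + y ^ 2)) ^ 2) ^ 2 / 64 +
      3 / 256 * (((1 - y ^ 2) / (1 + y ^ 2)) ^ 2) ^ 3) =
      (1 - y) ^ 4 * (17 / 256 + 51 / 128 * y + 333 / 256 * y ^ 2 + 101 / 32 * y ^ 3 +
        2257 / 128 * y ^ 4 + 953 / 64 * y ^ 5 + 2257 / 128 * y ^ 6 + 101 / 32 * y ^ 7 +
        333 / 256 * y ^ 8 + 51 / 128 * y ^ 9 + 17 / 256 * y ^ 10) /
        (50 * (1 + y) ^ 2 * (1 + y ^ 2) ^ 5) := by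
    field_simp
    ring
  rw [e]
  have : 0 < 1 - y := sub_pos.2 hy1
  positivity

lemma S52_sq_lt {y : ℝ} (hy0 : 1 / 5 ≤ y) (hy1 : y < 1) :
    S52 (y ^ 2) - 337 / 100000 < (1 + y ^ 2) / 2 * (1 + ((1 - y ^ 2) / (1 + y ^ 2)) ^ 2 / 4 +
      (((1 - y ^ 2) / (1 + y ^ 2)) ^ 2) ^ 2 / 64 + (((1 - y ^ 2) / (1 + y ^ 2)) ^ 2) ^ 3 / 256 +
      25 / 16384 * (((1 - y ^ 2) / (1 + y ^ 2)) ^ 2) ^ 4) := by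
  have hy : 0 < y := by linarith
  rw [S52_sq hy hy1, ← sub_pos]
  obtain ⟨u, hu⟩ : ∃ u, u = 5 * y - 1 := ⟨_, rfl⟩
  obtain ⟨w, hw⟩ : ∃ w, w = 1 - y := ⟨_, rfl⟩
  have hu0 : 0 ≤ u := by linarith
  have hw0 : 0 < w := by linarith
  have hpos : 0 < 100140509525 * w ^ 18 + 2578879896810 * u ^ 1 * w ^ 17 + 9954340473241 * u ^ 2 * w ^ 16
      + 19228794276928 * u ^ 3 * w ^ 15 + 23719223805748 * u ^ 4 * w ^ 14 + 20764636477096 * u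
      ^ 5 * w ^ 13 + 13653275996788 * u ^ 6 * w ^ 12 + 6971587808160 * u ^ 7 * w ^ 11 +
      2821023326262 * u ^ 8 * w ^ 10 + 915407495756 * u ^ 9 * w ^ 9 + 239578658142 * u ^ 10 *
      w ^ 8 + 50599058816 * u ^ 11 * w ^ 7 + 8583543268 * u ^ 12 * w ^ 6 + 1156945608 * u ^ 13
      * w ^ 5 + 121534276 * u ^ 14 * w ^ 4 + 9630112 * u ^ 15 * w ^ 3 + 543581 * u ^ 16 * w ^
      2 + 19546 * u ^ 17 * w ^ 1 + 337 * u ^ 18 := by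
    positivity
  have e : (1 + y ^ 2) / 2 * (1 + ((1 - y ^ 2) / (1 + y ^ 2)) ^ 2 / 4 +
      (((1 - y ^ 2) / (1 + y ^ 2)) ^ 2) ^ 2 / 64 + (((1 - y ^ 2) / (1 + y ^ 2)) ^ 2) ^ 3 / 256 +
      25 / 16384 * (((1 - y ^ 2) / (1 + y ^ 2)) ^ 2) ^ 4) -
      (16 / 25 * ((1 + y + y ^ 2 + y ^ 3 + y ^ 4) / ((1 + y) * (1 + y ^ 2))) ^ 2 -
        337 / 100000) =
      (100140509525 * w ^ 18 + 2578879896810 * u ^ 1 * w ^ 17 + 9954340473241 * u ^ 2 * w ^ 16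
      + 19228794276928 * u ^ 3 * w ^ 15 + 23719223805748 * u ^ 4 * w ^ 14 + 20764636477096 * u
      ^ 5 * w ^ 13 + 13653275996788 * u ^ 6 * w ^ 12 + 6971587808160 * u ^ 7 * w ^ 11 +
      2821023326262 * u ^ 8 * w ^ 10 + 915407495756 * u ^ 9 * w ^ 9 + 239578658142 * u ^ 10 *
      w ^ 8 + 50599058816 * u ^ 11 * w ^ 7 + 8583543268 * u ^ 12 * w ^ 6 + 1156945608 * u ^ 13
      * w ^ 5 + 121534276 * u ^ 14 * w ^ 4 + 9630112 * u ^ 15 * w ^ 3 + 543581 * u ^ 16 * w ^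
      2 + 19546 * u ^ 17 * w ^ 1 + 337 * u ^ 18) /
        (268435456000 * (50 * (1 + y) ^ 2 * (1 + y ^ 2) ^ 7)) := by
    rw [hu, hw]
    field_simp
    ring
  rw [e]
  positivity

lemma S52_sq_lt_of_le {y : ℝ} (hy0 : 0 < y) (hy1 : y ≤ 1 / 5) :
    S52 (y ^ 2) < 16 / 25 + 6366 / 10000 * (y ^ 4 * (248275 / 100000 - 4 * y)) := by
  rw [S52_sq hy0 (by linarith)]
  obtain ⟨τ, hτ⟩ : ∃ τ, τ = (1 + y) * (1 + y ^ 2) := ⟨_, rfl⟩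
  have hτ1 : 1 + y ≤ τ := by
    rw [hτ]
    nlinarith [pow_pos hy0 2, pow_pos hy0 3]
  have hτ0 : 0 < τ := by linarith
  have hσ : 1 + y + y ^ 2 + y ^ 3 + y ^ 4 = τ + y ^ 4 := by
    rw [hτ]
    ring
  have hy4 : y ^ 4 ≤ 1 / 625 := by
    calc y ^ 4 ≤ (1 / 5) ^ 4 := by gcongr
      _ = 1 / 625 := by norm_num
  have key : 16 / 25 * (2 * τ + y ^ 4) < 6366 / 10000 * (248275 / 100000 - 4 * y) * τ ^ 2 := by
    have h1 : 16 / 25 * (2 + 1 / 625) < 6366 / 10000 * (248275 / 100000 - 4 * y) * (1 + y) := by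
      nlinarith
    have h2 : 6366 / 10000 * (248275 / 100000 - 4 * y) * (1 + y) ≤
        6366 / 10000 * (248275 / 100000 - 4 * y) * τ :=
      mul_le_mul_of_nonneg_left hτ1 (by linarith)
    have h3 := mul_lt_mul_of_pos_right (h1.trans_le h2) hτ0
    nlinarith
  rw [← hτ, hσ, ← sub_pos]
  have e : 16 / 25 + 6366 / 10000 * (y ^ 4 * (248275 / 100000 - 4 * y)) -
      16 / 25 * ((τ + y ^ 4) / τ) ^ 2 =
      y ^ 4 * (6366 / 10000 * (248275 / 100000 - 4 * y) * τ ^ 2 -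
        16 / 25 * (2 * τ + y ^ 4)) / τ ^ 2 := by
    field_simp
    ring
  rw [e]
  have := sub_pos.2 key
  positivity

lemma lt_ellipticE_sub_S52_of_le {r y : ℝ} (hy0 : 0 < y) (hy1 : y ≤ 1 / 5)
    (hr : r ^ 2 = 1 - (y ^ 2) ^ 2) :
    2 / π - 16 / 25 < 2 / π * ellipticE r - S52 (y ^ 2) := by
  have hE := one_add_le_ellipticE (pow_pos hy0 2) hr
  have hl2 := log_two_gt_d9
  have h1 : log 2 ≤ log (2 + y ^ 2) := log_le_log two_pos (by nlinarith [pow_pos hy0 2])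
  have h2 : log (y ^ 2) = 2 * log y := by
    rw [log_pow]
    norm_num
  have h3 : 2 * log 2 + log y ≤ 4 * y - 1 := by
    have e : log (2 ^ 2 * y) = 2 * log 2 + log y := by
      rw [log_mul (by norm_num) hy0.ne', log_pow]
      norm_num
    rw [← e]
    refine (log_le_sub_one_of_pos (by positivity)).trans_eq ?_
    norm_num
  have h4 : 1 + y ^ 4 * (248275 / 100000 - 4 * y) ≤ ellipticE r := by
    refine le_trans ?_ hE
    rw [← pow_mul]
    have : 248275 / 100000 - 4 * y ≤ (log (2 + y ^ 2) - log (y ^ 2)) / 2 - 1 / 4 := by linarith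
    gcongr
  have hpi : 6366 / 10000 ≤ 2 / π := by
    rw [le_div_iff₀ pi_pos]
    linarith [pi_lt_d4]
  have h5 := mul_le_mul_of_nonneg_left h4 (show 0 ≤ 2 / π by positivity)
  have h6 : 6366 / 10000 * (y ^ 4 * (248275 / 100000 - 4 * y)) ≤
      2 / π * (y ^ 4 * (248275 / 100000 - 4 * y)) :=
    mul_le_mul_of_nonneg_right hpi (mul_nonneg (by positivity) (by linarith))
  linarith [S52_sq_lt_of_le hy0 hy1]

theorem ellipticE_sub_S52_bounds (r : ℝ) (hr : r ∈ Set.Ioo (0:ℝ) 1) :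
    2 / π - 16 / 25 < 2 / π * ellipticE r - S52 (Real.sqrt (1 - r ^ 2)) ∧
    2 / π * ellipticE r - S52 (Real.sqrt (1 - r ^ 2)) < 0 := by
  obtain ⟨hr0, hr1⟩ := hr
  have hx : 0 < 1 - r ^ 2 := by nlinarith
  obtain ⟨y, hy⟩ : ∃ y, y = √√(1 - r ^ 2) := ⟨_, rfl⟩
  have hy2 : √(1 - r ^ 2) = y ^ 2 := by rw [hy, sq_sqrt (sqrt_nonneg _)]
  have hry : r ^ 2 = 1 - (y ^ 2) ^ 2 := by
    rw [← hy2, sq_sqrt hx.le]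
    ring
  have hy0 : 0 < y := hy ▸ sqrt_pos.2 (sqrt_pos.2 hx)
  have hy1 : y ^ 2 < 1 := by
    rw [← hy2, sqrt_lt' one_pos]
    nlinarith
  have hy1' : y < 1 := by nlinarith
  rw [hy2]
  refine ⟨?_, by linarith [ellipticE_le (pow_pos hy0 2) hy1 hry, lt_S52_sq hy0 hy1']⟩
  rcases le_total y (1 / 5) with h | h
  · exact lt_ellipticE_sub_S52_of_le hy0 h hry
  · have hpi : 2 / π < 63663 / 100000 := by
      rw [div_lt_iff₀ pi_pos]
      linarith [pi_gt_d6]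
    linarith [le_ellipticE (pow_pos hy0 2) hy1 hry, S52_sq_lt h hy1']
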